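/- Let G be an abelian group (written additively). Suppose given six G-torsors P_ab, P_ac, P_ad, P_bc, P_bd, P_cd (nonempty sets with free transitive G-actions) and four composition maps μ_abc : P_ab × P_bc → P_ac, μ_abd : P_ab × P_bd → P_ad, μ_acd : P_ac × P_cd → P_ad, μ_bcd : P_bc × P_cd → P_bd, each of which is G-equivariant in both variables: μ(g + u, v) = g + μ(u, v) = μ(u, g + v) for all g ∈ G. Fix arbitrary elements s_ab ∈ P_ab, s_ac ∈ P_ac, s_ad ∈ P_ad, s_bc ∈ P_bc, s_bd ∈ P_bd, s_cd ∈ P_cd, and define f_a, f_b, f_c, f_d ∈ G by the equations μ_bcd(s_bc, s_cd) = f_a + s_bd, μ_acd(s_ac, s_cd) = f_b + s_ad, μ_abd(s_ab, s_bd) = f_c + s_ad, μ_abc(s_ab, s_bc) = f_d + s_ac. Then the associativity identity μ_acd(μ_abc(u, v), w) = μ_abd(u, μ_bcd(v, w)) holds for all u ∈ P_ab, v ∈ P_bc, w ∈ P_cd if and only if f_a + f_c = f_b + f_d. In particular, whether f_a + f_c = f_b + f_d holds does not depend on the choice of the elements s_xy. -/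

import Mathlib

/-- for six `G`-torsors `P_xy` with `G`-biequivariant compositions
`μ_xyz : P_xy × P_yz → P_xz`, and elements `f_a, f_b, f_c, f_d ∈ G` defined from
arbitrary chosen elements `s_xy ∈ P_xy` by `μ_bcd(s_bc, s_cd) = f_a +ᵥ s_bd`,
`μ_acd(s_ac, s_cd) = f_b +ᵥ s_ad`, `μ_abd(s_ab, s_bd) = f_c +ᵥ s_ad`,
`μ_abc(s_ab, s_bc) = f_d +ᵥ s_ac`, associativity `μ_acd(μ_abc(u,v),w) =
μ_abd(u, μ_bcd(v,w))` holds for all `u, v, w` iff `f_a + f_c = f_b + f_d`;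
in particular the latter condition does not depend on the chosen elements. -/
theorem stmt12 {G : Type*} [AddCommGroup G]
    {Pab Pac Pad Pbc Pbd Pcd : Type*}
    [AddTorsor G Pab] [AddTorsor G Pac] [AddTorsor G Pad]
    [AddTorsor G Pbc] [AddTorsor G Pbd] [AddTorsor G Pcd]
    (μabc : Pab → Pbc → Pac) (μabd : Pab → Pbd → Pad)
    (μacd : Pac → Pcd → Pad) (μbcd : Pbc → Pcd → Pbd)
    (habc₁ : ∀ (g : G) (u : Pab) (v : Pbc), μabc (g +ᵥ u) v = g +ᵥ μabc u v)
    (habc₂ : ∀ (g : G) (u : Pab) (v : Pbc), μabc u (g +ᵥ v) = g +ᵥ μabc u v)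
    (habd₁ : ∀ (g : G) (u : Pab) (v : Pbd), μabd (g +ᵥ u) v = g +ᵥ μabd u v)
    (habd₂ : ∀ (g : G) (u : Pab) (v : Pbd), μabd u (g +ᵥ v) = g +ᵥ μabd u v)
    (hacd₁ : ∀ (g : G) (u : Pac) (v : Pcd), μacd (g +ᵥ u) v = g +ᵥ μacd u v)
    (hacd₂ : ∀ (g : G) (u : Pac) (v : Pcd), μacd u (g +ᵥ v) = g +ᵥ μacd u v)
    (hbcd₁ : ∀ (g : G) (u : Pbc) (v : Pcd), μbcd (g +ᵥ u) v = g +ᵥ μbcd u v)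
    (hbcd₂ : ∀ (g : G) (u : Pbc) (v : Pcd), μbcd u (g +ᵥ v) = g +ᵥ μbcd u v)
    (sab : Pab) (sac : Pac) (sad : Pad) (sbc : Pbc) (sbd : Pbd) (scd : Pcd)
    (fa fb fc fd : G)
    (hfa : μbcd sbc scd = fa +ᵥ sbd)
    (hfb : μacd sac scd = fb +ᵥ sad)
    (hfc : μabd sab sbd = fc +ᵥ sad)
    (hfd : μabc sab sbc = fd +ᵥ sac) :
    ((∀ (u : Pab) (v : Pbc) (w : Pcd),
        μacd (μabc u v) w = μabd u (μbcd v w)) ↔ fa + fc = fb + fd) ∧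
    (∀ (sab' : Pab) (sac' : Pac) (sad' : Pad) (sbc' : Pbc) (sbd' : Pbd) (scd' : Pcd)
        (fa' fb' fc' fd' : G),
        μbcd sbc' scd' = fa' +ᵥ sbd' →
        μacd sac' scd' = fb' +ᵥ sad' →
        μabd sab' sbd' = fc' +ᵥ sad' →
        μabc sab' sbc' = fd' +ᵥ sac' →
        (fa' + fc' = fb' + fd' ↔ fa + fc = fb + fd)) := by
  have key : ∀ (sab : Pab) (sac : Pac) (sad : Pad) (sbc : Pbc) (sbd : Pbd) (scd : Pcd)
      (fa fb fc fd : G),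
      μbcd sbc scd = fa +ᵥ sbd → μacd sac scd = fb +ᵥ sad →
      μabd sab sbd = fc +ᵥ sad → μabc sab sbc = fd +ᵥ sac →
      ((∀ (u : Pab) (v : Pbc) (w : Pcd),
        μacd (μabc u v) w = μabd u (μbcd v w)) ↔ fa + fc = fb + fd) := by
    intro sab sac sad sbc sbd scd fa fb fc fd hfa hfb hfc hfd
    have hl : μacd (μabc sab sbc) scd = (fb + fd) +ᵥ sad := by
      rw [hfd, hacd₁, hfb, vadd_vadd, add_comm]
    have hr : μabd sab (μbcd sbc scd) = (fa + fc) +ᵥ sad := by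
      rw [hfa, habd₂, hfc, vadd_vadd]
    constructor
    · intro h
      have h₀ := h sab sbc scd
      rw [hl, hr] at h₀
      exact (vadd_right_cancel sad h₀).symm
    · intro h u v w
      rw [← vsub_vadd u sab, ← vsub_vadd v sbc, ← vsub_vadd w scd]
      simp only [habc₁, habc₂, habd₁, habd₂, hacd₁, hacd₂, hbcd₁, hbcd₂, hl, hr, h, vadd_vadd]
      congr 1
      abel
  refine ⟨key sab sac sad sbc sbd scd fa fb fc fd hfa hfb hfc hfd, ?_⟩
  intro sab' sac' sad' sbc' sbd' scd' fa' fb' fc' fd' ha hb hc hd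
  exact (key sab' sac' sad' sbc' sbd' scd' fa' fb' fc' fd' ha hb hc hd).symm.trans
    (key sab sac sad sbc sbd scd fa fb fc fd hfa hfb hfc hfd)
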